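/- arXiv:0706.1001 — 3 statements merged into one kernel-verified Lean document; each statement's English description precedes it below -/
import Mathlib

section
/- Suppose each property φ_i is monotonic. Then G_{CB(φ̄)} ⊆ T_{φ̄}^∞: every strategy chosen by some player i in a state ω such that, for some belief correspondences, ω ∈ RAT(φ̄) and RAT(φ̄) is common belief at ω, belongs to the i-th component of the outcome of the transfinite iteration of the operator T_{φ̄}. -/
universe u

/-- The α-th transfinite iterate of an operator `T` on a complete lattice,
starting at the largest element `⊤`: `T^0 = ⊤`, `T^(α+1) = T (T^α)`,
and `T^β = ⋂_{α<β} T^α` for limit ordinals `β`. -/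
noncomputable def iterOp {D : Type u} [CompleteLattice D] (T : D → D) (α : Ordinal.{u}) : D :=
  Ordinal.limitRecOn α ⊤ (fun _ x => T x)
    (fun β _ IH => ⨅ γ : {γ : Ordinal // γ < β}, IH γ.1 γ.2)

/-- The closure ordinal of `T`: the least `α` with `T^(α+1) = T^α`. -/
noncomputable def closureOrd {D : Type u} [CompleteLattice D] (T : D → D) : Ordinal.{u} :=
  sInf {α : Ordinal | iterOp T (α + 1) = iterOp T α}

/-- The outcome `T^∞` of iterating `T`: the iterate at the closure ordinal. -/
noncomputable def outcomeOp {D : Type u} [CompleteLattice D] (T : D → D) : D :=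
  iterOp T (closureOrd T)

/-- The operator `T_φ` on restrictions: it removes from each component `G i` the
strategies `s` for which `φ i s G` fails. -/
def TOp {ι : Type*} {T : ι → Type*} (φ : ∀ i : ι, T i → (∀ j, Set (T j)) → Prop)
    (G : ∀ j, Set (T j)) : ∀ j, Set (T j) :=
  fun i => {s ∈ G i | φ i s G}

/-- A belief correspondence: nonempty values, and `ω' ∈ P(ω)` implies `P(ω') = P(ω)`. -/
def BeliefCorr {Ω : Type*} (P : Ω → Set Ω) : Prop :=
  (∀ ω, (P ω).Nonempty) ∧ ∀ ω ω', ω' ∈ P ω → P ω' = P ω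

/-- A knowledge correspondence: a belief correspondence with `ω ∈ P(ω)`. -/
def KnowledgeCorr {Ω : Type*} (P : Ω → Set Ω) : Prop :=
  BeliefCorr P ∧ ∀ ω, ω ∈ P ω

/-- An event `F` is evident if `P_i(ω) ⊆ F` for all `ω ∈ F` and all players `i`. -/
def EvidentEvent {ι Ω : Type*} (P : ι → Ω → Set Ω) (F : Set Ω) : Prop :=
  ∀ ω ∈ F, ∀ i, P i ω ⊆ F

/-- `E` is common knowledge at `ω`: some evident `F` satisfies `ω ∈ F ⊆ E`. -/
def CommonKnowledgeAt {ι Ω : Type*} (P : ι → Ω → Set Ω) (E : Set Ω) (ω : Ω) : Prop :=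
  ∃ F : Set Ω, EvidentEvent P F ∧ ω ∈ F ∧ F ⊆ E

/-- The belief operator `B E = {ω | ∀ i, P_i(ω) ⊆ E}`. -/
def beliefOp {ι Ω : Type*} (P : ι → Ω → Set Ω) (E : Set Ω) : Set Ω :=
  {ω | ∀ i, P i ω ⊆ E}

/-- `E` is common belief at `ω`: some evident `F` satisfies `ω ∈ F ⊆ B E`. -/
def CommonBeliefAt {ι Ω : Type*} (P : ι → Ω → Set Ω) (E : Set Ω) (ω : Ω) : Prop :=
  ∃ F : Set Ω, EvidentEvent P F ∧ ω ∈ F ∧ F ⊆ beliefOp P E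

/-- The restriction `G_E` determined by an event `E`: its `i`-th component is
`{s_i(ω') | ω' ∈ E}`. -/
def restrOf {ι Ω : Type*} {T : ι → Type*} (σ : ∀ i : ι, Ω → T i) (E : Set Ω) :
    ∀ i, Set (T i) :=
  fun i => σ i '' E

/-- `RAT(φ̄)`: the set of states at which each player `i` is `φ_i`-rational, i.e.
`φ_i(s_i(ω), G_{P_i(ω)})` holds. -/
def RATset {ι Ω : Type*} {T : ι → Type*} (φ : ∀ i : ι, T i → (∀ j, Set (T j)) → Prop)
    (σ : ∀ i : ι, Ω → T i) (P : ι → Ω → Set Ω) : Set Ω :=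
  {ω | ∀ i, φ i (σ i ω) (restrOf σ (P i ω))}

/-- `CK(φ̄)`: states at which, for some knowledge correspondences, `RAT(φ̄)` is
common knowledge. -/
def CKset {ι Ω : Type*} {T : ι → Type*} (φ : ∀ i : ι, T i → (∀ j, Set (T j)) → Prop)
    (σ : ∀ i : ι, Ω → T i) : Set Ω :=
  {ω | ∃ P : ι → Ω → Set Ω, (∀ i, KnowledgeCorr (P i)) ∧
        CommonKnowledgeAt P (RATset φ σ P) ω}

/-- `CB(φ̄)`: states `ω` at which, for some belief correspondences, `ω ∈ RAT(φ̄)`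
and `RAT(φ̄)` is common belief at `ω`. -/
def CBset {ι Ω : Type*} {T : ι → Type*} (φ : ∀ i : ι, T i → (∀ j, Set (T j)) → Prop)
    (σ : ∀ i : ι, Ω → T i) : Set Ω :=
  {ω | ∃ P : ι → Ω → Set Ω, (∀ i, BeliefCorr (P i)) ∧
        ω ∈ RATset φ σ P ∧ CommonBeliefAt P (RATset φ σ P) ω}

/-- A post-fixed point of a monotone operator lies below every iterate from `⊤`. -/
theorem le_iterOp {D : Type u} [CompleteLattice D] {T : D → D} (hT : Monotone T) {x : D}
    (hx : x ≤ T x) (α : Ordinal.{u}) : x ≤ iterOp T α := by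
  induction α using Ordinal.limitRecOn with
  | zero => simp [iterOp]
  | add_one α ih =>
    have h : iterOp T (α + 1) = T (iterOp T α) := by
      simp [iterOp]
    exact h ▸ hx.trans (hT ih)
  | limit β hβ ih =>
    rw [iterOp, Ordinal.limitRecOn_limit _ _ _ _ hβ]
    exact le_iInf fun γ => ih γ.1 γ.2

theorem TOp_monotone {ι : Type*} {T : ι → Type*} {φ : ∀ i : ι, T i → (∀ j, Set (T j)) → Prop}
    (hmono : ∀ (i : ι) (s : T i) (G G' : ∀ j, Set (T j)),
      (∀ j, G j ⊆ G' j) → φ i s G → φ i s G') : Monotone (TOp φ) :=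
  fun G G' h i s hs => ⟨h i hs.1, hmono i s G G' h hs.2⟩

/-- If each `φ_i` is monotonic, then `G_{CB(φ̄)} ⊆ T_{φ̄}^∞`: every strategy chosen
by player `i` in a state where `RAT(φ̄)` is true and common belief (for some belief
correspondences) survives the transfinite iteration of `T_{φ̄}`. -/
theorem GCB_subset_outcome {ι Ω : Type*} [Fintype ι] [Nontrivial ι] {T : ι → Type*}
    [∀ j, Nonempty (T j)] (p : ∀ i : ι, (∀ j, T j) → ℝ)
    (φ : ∀ i : ι, T i → (∀ j, Set (T j)) → Prop)
    (hmono : ∀ (i : ι) (s : T i) (G G' : ∀ j, Set (T j)),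
      (∀ j, G j ⊆ G' j) → φ i s G → φ i s G')
    (σ : ∀ i : ι, Ω → T i) (i : ι) :
    σ i '' CBset φ σ ⊆ outcomeOp (TOp φ) i := by
  rintro _ ⟨ω, ⟨P, -, hω, F, hF, hωF, hFB⟩, rfl⟩
  refine le_iterOp (TOp_monotone hmono) (x := restrOf σ (F ∩ RATset φ σ P)) ?_ _ i
    ⟨ω, ⟨hωF, hω⟩, rfl⟩
  rintro j _ ⟨ω', hω', rfl⟩
  exact ⟨⟨ω', hω', rfl⟩, hmono j _ _ _
    (fun k => Set.image_mono (Set.subset_inter (hF ω' hω'.1 j) (hFB hω'.1 j))) (hω'.2 j)⟩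
end

section
/- Suppose property A holds (for each strategy s_i ∈ T_i there is a state ω ∈ Ω with s_i = s_i(ω)) and each φ_i satisfies φ_i(s_i, ({s_1},...,{s_n})) for all i and all joint strategies (s_1,...,s_n). Then G_{CK(φ̄)} = G_{CB(φ̄)} = H: common knowledge (or truth together with common belief) of φ̄-rationality does not exclude any strategy of any player. -/
/-- The partition `{ω}` makes every player rational at every state if each `φ i` holds at
all singleton restrictions. -/
theorem RATset_singleton_eq_univ {ι Ω : Type*} {T : ι → Type*}
    (φ : ∀ i : ι, T i → (∀ j, Set (T j)) → Prop) (σ : ∀ i : ι, Ω → T i)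
    (hφ : ∀ (s : ∀ j, T j) (i : ι), φ i (s i) (fun j => ({s j} : Set (T j)))) :
    RATset φ σ (fun _ ω => {ω}) = Set.univ := by
  refine Set.eq_univ_of_forall fun ω i => ?_
  have hr : restrOf σ {ω} = fun j => ({σ j ω} : Set (T j)) := funext fun _ => Set.image_singleton
  change φ i (σ i ω) (restrOf σ {ω})
  exact hr ▸ hφ (fun j => σ j ω) i

theorem knowledgeCorr_singleton {Ω : Type*} : KnowledgeCorr (fun ω : Ω => ({ω} : Set Ω)) :=
  ⟨⟨Set.singleton_nonempty, fun _ _ h => congrArg _ h⟩, Set.mem_singleton⟩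

/-- If each choice function `s_i : Ω → T i` is onto (property A) and each `φ_i`
holds at all singleton restrictions, then `G_{CK(φ̄)} = G_{CB(φ̄)} = H`: common
knowledge (or truth and common belief) of `φ̄`-rationality excludes no strategy. -/
theorem GCK_eq_GCB_eq_H {ι Ω : Type*} [Fintype ι] [Nontrivial ι] {T : ι → Type*}
    [∀ j, Nonempty (T j)] (p : ∀ i : ι, (∀ j, T j) → ℝ)
    (φ : ∀ i : ι, T i → (∀ j, Set (T j)) → Prop)
    (σ : ∀ i : ι, Ω → T i)
    (hA : ∀ i, Function.Surjective (σ i))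
    (hφ : ∀ (s : ∀ j, T j) (i : ι), φ i (s i) (fun j => ({s j} : Set (T j))))
    (i : ι) :
    σ i '' CKset φ σ = Set.univ ∧ σ i '' CBset φ σ = Set.univ := by
  have hR := RATset_singleton_eq_univ φ σ hφ
  have hCK : CKset φ σ = Set.univ := Set.eq_univ_of_forall fun ω =>
    ⟨_, fun _ => knowledgeCorr_singleton, Set.univ, fun _ _ _ => Set.subset_univ _,
      Set.mem_univ ω, hR.ge⟩
  have hCB : CBset φ σ = Set.univ := Set.eq_univ_of_forall fun ω =>
    ⟨_, fun _ => knowledgeCorr_singleton.1, hR.ge (Set.mem_univ ω), Set.univ,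
      fun _ _ _ => Set.subset_univ _, Set.mem_univ ω,
      fun _ _ _ => (Set.subset_univ _).trans hR.ge⟩
  rw [hCK, hCB, Set.image_univ, (hA i).range_eq]
  exact ⟨rfl, rfl⟩
end

section
/- For every finite strategic game H and every restriction G of H: T_{brc^l}(G) = T_{msd^l}(G). That is, a strategy s_i ∈ S_i is a best response within S_i to some correlated strategy of the opponents over S_{-i} if and only if s_i is not strictly dominated on G by any mixed strategy of player i over S_i. -/
/-- Expected payoff of player `i` when playing the mixed strategy `m` against the
joint strategy of the opponents determined by the profile `t`. -/
noncomputable def mixedPayoff {ι : Type*} [DecidableEq ι] {T : ι → Type*}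
    [∀ j, Fintype (T j)] (p : ∀ i : ι, (∀ j, T j) → ℝ)
    (i : ι) (m : T i → ℝ) (t : ∀ j, T j) : ℝ :=
  ∑ x : T i, m x * p i (Function.update t i x)

/-- `msd^l(s, G)`: `s` is not strictly dominated on `G` by any mixed strategy of
player `i` with support contained in `G i`. -/
def msdL {ι : Type*} [DecidableEq ι] {T : ι → Type*} [∀ j, Fintype (T j)]
    (p : ∀ i : ι, (∀ j, T j) → ℝ) (i : ι) (s : T i) (G : ∀ j, Set (T j)) : Prop :=
  ¬ ∃ m : T i → ℝ, (∀ x, 0 ≤ m x) ∧ (∑ x : T i, m x) = 1 ∧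
    (∀ x, m x ≠ 0 → x ∈ G i) ∧
    ∀ t : ∀ j, T j, (∀ j, j ≠ i → t j ∈ G j) →
      mixedPayoff p i m t > p i (Function.update t i s)

/-- Expected payoff of the pure strategy `s` of player `i` against a correlated
strategy `μ` of the opponents (represented as a distribution over profiles;
only the opponents' components matter, since coordinate `i` is overwritten). -/
noncomputable def corrPayoff {ι : Type*} [Fintype ι] [DecidableEq ι] {T : ι → Type*}
    [∀ j, Fintype (T j)] (p : ∀ i : ι, (∀ j, T j) → ℝ)
    (i : ι) (μ : (∀ j, T j) → ℝ) (s : T i) : ℝ :=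
  ∑ t : ∀ j, T j, μ t * p i (Function.update t i s)

/-- `brc^l(s, G)`: `s` is a best response within `G i` to some correlated strategy
of the opponents over `G_{-i}` (a distribution with support in `G_{-i}`). -/
def brcL {ι : Type*} [Fintype ι] [DecidableEq ι] {T : ι → Type*} [∀ j, Fintype (T j)]
    (p : ∀ i : ι, (∀ j, T j) → ℝ) (i : ι) (s : T i) (G : ∀ j, Set (T j)) : Prop :=
  ∃ μ : (∀ j, T j) → ℝ, (∀ t, 0 ≤ μ t) ∧ (∑ t : ∀ j, T j, μ t) = 1 ∧
    (∀ t : ∀ j, T j, μ t ≠ 0 → ∀ j, j ≠ i → t j ∈ G j) ∧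
    ∀ s' ∈ G i, corrPayoff p i μ s ≥ corrPayoff p i μ s'

/-- Theorem of the alternative for the matrix `a` whose rows are restricted to `A` and whose
columns are restricted to `B`. -/
theorem exists_nonpos_combination_of_not_exists_pos_combination {α β : Type*} [Fintype α]
    [Fintype β] (a : α → β → ℝ) {A : Set α} (B : Set β) (hA : A.Nonempty)
    (h : ¬ ∃ m : α → ℝ, (∀ x, 0 ≤ m x) ∧ ∑ x, m x = 1 ∧ (∀ x, m x ≠ 0 → x ∈ A) ∧
      ∀ y ∈ B, 0 < ∑ x, m x * a x y) :
    ∃ μ : β → ℝ, (∀ y, 0 ≤ μ y) ∧ ∑ y, μ y = 1 ∧ (∀ y, μ y ≠ 0 → y ∈ B) ∧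
      ∀ x ∈ A, ∑ y, μ y * a x y ≤ 0 := by
  classical
  let M : Set (α → ℝ) := {m | (∀ x, 0 ≤ m x) ∧ ∑ x, m x = 1 ∧ ∀ x, m x ≠ 0 → x ∈ A}
  let C : Set (β → ℝ) := Fintype.linearCombination ℝ a '' M
  let D : Set (β → ℝ) := B.pi fun _ => Set.Ioi 0
  have hM : Convex ℝ M := by
    rintro m ⟨m0, m1, m2⟩ n ⟨n0, n1, n2⟩ r s hr hs hrs
    refine ⟨fun x => ?_, ?_, fun x hx => ?_⟩
    · have := m0 x
      have := n0 x
      simp only [Pi.add_apply, Pi.smul_apply, smul_eq_mul]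
      positivity
    · simp [Finset.sum_add_distrib, ← Finset.mul_sum, m1, n1, hrs]
    · by_contra hxA
      have hm := not_not.1 (mt (m2 x) hxA)
      have hn := not_not.1 (mt (n2 x) hxA)
      exact hx (by simp [hm, hn])
  have hD : Convex ℝ D := convex_pi fun _ _ => convex_Ioi 0
  have hDo : IsOpen D := isOpen_set_pi B.toFinite fun _ _ => isOpen_Ioi
  have hsingle : ∀ x ∈ A, a x ∈ C := by
    intro x hx
    refine ⟨Pi.single x 1, ⟨fun z => ?_, by simp, fun z hz => ?_⟩, by simp⟩
    · by_cases hz : z = x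
      · subst hz; simp
      · simp [hz]
    · by_cases hzx : z = x
      · exact hzx ▸ hx
      · simp [hzx] at hz
  have hdisj : Disjoint D C := by
    rw [Set.disjoint_left]
    rintro _ hd ⟨m, ⟨m0, m1, m2⟩, rfl⟩
    refine h ⟨m, m0, m1, m2, fun y hy => ?_⟩
    simpa [Fintype.linearCombination_apply] using hd y hy
  obtain ⟨f, u, hfD, hfC⟩ :=
    geometric_hahn_banach_open hD hDo (hM.linear_image _) hdisj
  have hf : ∀ v, f v = ∑ y, v y * f (Pi.single y 1) := fun v => by
    conv_lhs => rw [pi_eq_sum_univ' v]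
    simp [map_sum, Pi.single]
  have hone : f 1 < u := hfD 1 fun _ _ => by simp
  have hu : 0 ≤ u := by
    by_contra! hu
    have h1 : f 1 < 0 := hone.trans hu
    have := hfD ((u / f 1) • 1) fun _ _ => by
      simpa using div_pos_of_neg_of_neg hu h1
    rw [map_smul, smul_eq_mul, div_mul_cancel₀ _ h1.ne] at this
    exact this.false
  have key : ∀ y (r : ℝ), (y ∈ B → 0 ≤ r) → f 1 + r * f (Pi.single y 1) < u := by
    intro y r hr
    have := hfD (1 + r • Pi.single y 1) fun z hz => by
      by_cases hzy : z = y
      · subst hzy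
        have := hr hz
        simp
        linarith
      · simp [hzy]
    simpa using this
  have hnonpos : ∀ y, f (Pi.single y 1) ≤ 0 := by
    intro y
    by_contra! hy
    have := key y ((u - f 1) / f (Pi.single y 1)) fun _ => by
      have := sub_pos.2 hone
      positivity
    rw [div_mul_cancel₀ _ hy.ne'] at this
    linarith
  have hzero : ∀ y ∉ B, f (Pi.single y 1) = 0 := by
    intro y hyB
    by_contra hy
    have := key y ((u - f 1) / f (Pi.single y 1)) fun hB => absurd hB hyB
    rw [div_mul_cancel₀ _ hy] at this
    linarith
  have hneg : f 1 < 0 := by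
    refine lt_of_le_of_ne (by simpa [hf 1] using Finset.sum_nonpos fun y _ => hnonpos y) ?_
    intro h1
    have h0 : ∀ y, f (Pi.single y 1) = 0 := by
      have := (Finset.sum_eq_zero_iff_of_nonpos fun y _ => hnonpos y).1
        (by simpa [hf 1] using h1)
      exact fun y => this y (Finset.mem_univ y)
    obtain ⟨x, hx⟩ := hA
    have hfx := hfC _ (hsingle x hx)
    rw [hf] at hfx
    simp only [h0, mul_zero, Finset.sum_const_zero] at hfx
    linarith
  refine ⟨fun y => f (Pi.single y 1) / f 1,
    fun y => div_nonneg_of_nonpos (hnonpos y) hneg.le, ?_, fun y hy => ?_, fun x hx => ?_⟩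
  · rw [← Finset.sum_div, div_eq_one_iff_eq hneg.ne, hf 1]
    simp
  · by_contra hyB
    exact hy (by simp [hzero y hyB])
  · have hfx : 0 ≤ f (a x) := hu.trans (hfC _ (hsingle x hx))
    calc ∑ y, f (Pi.single y 1) / f 1 * a x y = f (a x) / f 1 := by
          rw [hf (a x), Finset.sum_div]
          exact Finset.sum_congr rfl fun y _ => by ring
      _ ≤ 0 := div_nonpos_of_nonneg_of_nonpos hfx hneg.le

/-- A best response to a correlated strategy is not strictly dominated by a mixed strategy. -/
theorem msdL_of_brcL {ι : Type*} [Fintype ι] [DecidableEq ι] {T : ι → Type*}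
    [∀ j, Fintype (T j)] {p : ∀ i : ι, (∀ j, T j) → ℝ} {G : ∀ j, Set (T j)} {i : ι} {s : T i}
    (h : brcL p i s G) : msdL p i s G := by
  rintro ⟨m, m0, m1, m2, hm⟩
  obtain ⟨μ, μ0, μ1, μ2, hμ⟩ := h
  have hlt : corrPayoff p i μ s < ∑ t, μ t * mixedPayoff p i m t := by
    obtain ⟨t, -, ht⟩ : ∃ t ∈ Finset.univ, 0 < μ t :=
      Finset.exists_lt_of_sum_lt (by simp [μ1])
    refine Finset.sum_lt_sum (fun t _ => ?_) ⟨t, Finset.mem_univ t, ?_⟩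
    · by_cases h0 : μ t = 0
      · simp [h0]
      · exact mul_le_mul_of_nonneg_left (hm t (μ2 t h0)).le (μ0 t)
    · exact mul_lt_mul_of_pos_left (hm t (μ2 t ht.ne')) ht
  have hswap : ∑ t, μ t * mixedPayoff p i m t = ∑ x, m x * corrPayoff p i μ x := by
    simp only [mixedPayoff, corrPayoff, Finset.mul_sum]
    rw [Finset.sum_comm]
    exact Finset.sum_congr rfl fun x _ => Finset.sum_congr rfl fun t _ => by ring
  have hle : ∑ x, m x * corrPayoff p i μ x ≤ ∑ x, m x * corrPayoff p i μ s := by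
    refine Finset.sum_le_sum fun x _ => ?_
    by_cases h0 : m x = 0
    · simp [h0]
    · exact mul_le_mul_of_nonneg_left (hμ x (m2 x h0)) (m0 x)
  rw [← Finset.sum_mul, m1, one_mul] at hle
  linarith

/-- A strategy not strictly dominated by a mixed strategy is a best response to a correlated
strategy. -/
theorem brcL_of_msdL {ι : Type*} [Fintype ι] [DecidableEq ι] {T : ι → Type*}
    [∀ j, Fintype (T j)] {p : ∀ i : ι, (∀ j, T j) → ℝ} {G : ∀ j, Set (T j)} {i : ι} {s : T i}
    (hs : s ∈ G i) (h : msdL p i s G) : brcL p i s G := by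
  obtain ⟨μ, μ0, μ1, μ2, hμ⟩ := exists_nonpos_combination_of_not_exists_pos_combination
    (fun x t => p i (Function.update t i x) - p i (Function.update t i s))
    {t | ∀ j, j ≠ i → t j ∈ G j} ⟨s, hs⟩ <| by
      rintro ⟨m, m0, m1, m2, hm⟩
      refine h ⟨m, m0, m1, m2, fun t ht => ?_⟩
      have := hm t ht
      simpa [mul_sub, Finset.sum_sub_distrib, ← Finset.sum_mul, m1, mixedPayoff] using this
  refine ⟨μ, μ0, μ1, μ2, fun x hx => ?_⟩
  have := hμ x hx
  simpa [mul_sub, Finset.sum_sub_distrib, corrPayoff] using this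

/-- For every finite game and every restriction `G`: `T_{brc^l}(G) = T_{msd^l}(G)`.
A strategy `s ∈ G i` is a best response within `G i` to some correlated strategy of
the opponents over `G_{-i}` iff it is not strictly dominated on `G` by any mixed
strategy over `G i`. -/
theorem TbrcL_eq_TmsdL {ι : Type*} [Fintype ι] [Nontrivial ι] [DecidableEq ι]
    {T : ι → Type*} [∀ j, Fintype (T j)] [∀ j, Nonempty (T j)]
    (p : ∀ i : ι, (∀ j, T j) → ℝ) (G : ∀ j, Set (T j)) (i : ι) :
    TOp (brcL p) G i = TOp (msdL p) G i := by
  ext s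
  exact ⟨fun ⟨hs, h⟩ => ⟨hs, msdL_of_brcL h⟩, fun ⟨hs, h⟩ => ⟨hs, brcL_of_msdL hs h⟩⟩
end
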